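/- For every integer n ≥ 2, liminf_{H→∞} #Ē_n(H) / #E_n(H) ≥ 1 + γ_n, where γ_n = 2^{−(n²+n)} (1 − τ_n/ρ_n); moreover γ_n > 0. -/

import Mathlib

open Polynomial Filter

/-- `f ∈ ℤ[x]` is Eisenstein with respect to the prime `p`:
`p ∣ aᵢ` for all `i` below the degree, `p² ∤ a₀` and `p ∤ aₙ`. -/
def IsEisensteinWith (f : Polynomial ℤ) (p : ℕ) : Prop :=
  (∀ i < f.natDegree, (p : ℤ) ∣ f.coeff i) ∧ ¬ ((p : ℤ)^2 ∣ f.coeff 0) ∧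
    ¬ ((p : ℤ) ∣ f.leadingCoeff)
/-- `f` is an Eisenstein polynomial: it is Eisenstein with respect to some prime. -/
def IsEisenstein (f : Polynomial ℤ) : Prop :=
  ∃ p : ℕ, p.Prime ∧ IsEisensteinWith f p
/-- Height of an integer polynomial: the maximum of the absolute values of its coefficients. -/
def polyHeight (f : Polynomial ℤ) : ℕ :=
  (Finset.range (f.natDegree + 1)).sup fun i => (f.coeff i).natAbs
/-- `E_n(H)`: the set of Eisenstein polynomials of degree exactly `n` and height at most `H`. -/
def EisensteinSet (n H : ℕ) : Set (Polynomial ℤ) :=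
  {f | f.natDegree = n ∧ polyHeight f ≤ H ∧ IsEisenstein f}
/-- `ρₙ = 1 - ∏_p (1 - (p-1)²/pⁿ⁺²)`, the product running over all primes. -/
noncomputable def rho (n : ℕ) : ℝ :=
  1 - ∏' p : Nat.Primes, (1 - ((p : ℕ) - 1 : ℝ)^2 / ((p : ℕ) : ℝ)^(n + 2))
/-- `τₙ = (∑_p (p-1)²/pⁿ⁺²)² - ∑_p (p-1)⁴/p²ⁿ⁺⁴`, the sums running over all primes. -/
noncomputable def tau (n : ℕ) : ℝ :=
  (∑' p : Nat.Primes, ((p : ℕ) - 1 : ℝ)^2 / ((p : ℕ) : ℝ)^(n + 2))^2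
    - ∑' p : Nat.Primes, ((p : ℕ) - 1 : ℝ)^4 / ((p : ℕ) : ℝ)^(2*n + 4)

/-- `Ē_n(H)`: the set of shifted Eisenstein polynomials of degree exactly `n` and height
at most `H`. -/
def shiftedEisensteinSet (n H : ℕ) : Set (Polynomial ℤ) :=
  {f | f.natDegree = n ∧ polyHeight f ≤ H ∧ ∃ s : ℤ, IsEisenstein (f.comp (X + C s))}

/-- The density `(p-1)²/pⁿ⁺²` of the polynomials of degree `n` that are Eisenstein at `p`. -/
noncomputable def eisensteinDensity (n : ℕ) (p : Nat.Primes) : ℝ :=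
  ((p : ℕ) - 1 : ℝ)^2 / ((p : ℕ) : ℝ)^(n + 2)

lemma eisensteinDensity_nonneg (n : ℕ) (p : Nat.Primes) : 0 ≤ eisensteinDensity n p := by
  unfold eisensteinDensity; positivity

/-- A summable sequence on `ℕ` dominating the densities `eisensteinDensity 2 p`, where the prime `2`
is placed at index `0` and an odd prime `p` at index `p / 2`. -/
noncomputable def densityMajorant (j : ℕ) : ℝ :=
  if j = 0 then 1 / 16 else if j = 1 then 4 / 81 else 1 / (4 * (j : ℝ) * (j + 1))

lemma densityMajorant_nonneg (j : ℕ) : 0 ≤ densityMajorant j := by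
  unfold densityMajorant; split_ifs <;> positivity

lemma sum_range_densityMajorant_le (N : ℕ) :
    ∑ j ∈ Finset.range N, densityMajorant j ≤ 1 / 16 + 4 / 81 + 1 / 8 := by
  have closed : ∀ M : ℕ, ∑ j ∈ Finset.range (M + 2), densityMajorant j =
      1 / 16 + 4 / 81 + (1 / 8 - 1 / (4 * ((M : ℝ) + 2))) := by
    intro M
    induction M with
    | zero => norm_num [Finset.sum_range_succ, densityMajorant]
    | succ M ih =>
      rw [show M + 1 + 2 = (M + 2) + 1 by ring, Finset.sum_range_succ, ih]
      have h1 : M + 2 ≠ 0 := by omega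
      have h2 : M + 2 ≠ 1 := by omega
      simp only [densityMajorant, h1, h2, if_false]
      push_cast
      field_simp
      ring
  calc ∑ j ∈ Finset.range N, densityMajorant j
      ≤ ∑ j ∈ Finset.range (N + 2), densityMajorant j :=
        Finset.sum_le_sum_of_subset_of_nonneg (by simp)
          fun j _ _ => densityMajorant_nonneg j
    _ ≤ _ := by
        rw [closed]
        have : 0 ≤ 1 / (4 * ((N : ℝ) + 2)) := by positivity
        linarith

lemma summable_densityMajorant : Summable densityMajorant :=
  summable_of_sum_range_le densityMajorant_nonneg sum_range_densityMajorant_le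

/-- The position of a prime in `densityMajorant`. -/
def primeIndex (p : Nat.Primes) : ℕ := if (p : ℕ) = 2 then 0 else (p : ℕ) / 2

lemma primeIndex_injective : Function.Injective primeIndex := by
  intro p q h
  have hp := p.2.two_le
  have hq := q.2.two_le
  have hp2 := p.2.eq_two_or_odd
  have hq2 := q.2.eq_two_or_odd
  apply Subtype.ext
  unfold primeIndex at h
  change (p : ℕ) = q
  split_ifs at h <;> omega

lemma eisensteinDensity_two_le (p : Nat.Primes) :
    eisensteinDensity 2 p ≤ densityMajorant (primeIndex p) := by
  have hp := p.2.two_le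
  rcases p.2.eq_two_or_odd with h | h
  · norm_num [eisensteinDensity, primeIndex, densityMajorant, h]
  · obtain ⟨j, hj⟩ : ∃ j, (p : ℕ) = 2 * j + 1 := ⟨(p : ℕ) / 2, by omega⟩
    have hi : primeIndex p = j := by
      unfold primeIndex; split_ifs <;> omega
    rw [hi]
    by_cases h1 : j = 1
    · subst h1
      norm_num [eisensteinDensity, densityMajorant, hj]
    · have h0 : 1 ≤ j := by omega
      simp only [eisensteinDensity, densityMajorant, hj, h1, show j ≠ 0 by omega, if_false]
      have : (1 : ℝ) ≤ j := by exact_mod_cast h0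
      push_cast
      rw [div_le_div_iff₀ (by positivity) (by positivity)]
      nlinarith [pow_pos (by linarith : (0 : ℝ) < j) 2, pow_pos (by linarith : (0 : ℝ) < j) 3]

lemma eisensteinDensity_le (d : ℕ) (p : Nat.Primes) :
    eisensteinDensity (d + 2) p ≤ (1 / 2) ^ d * densityMajorant (primeIndex p) := by
  refine le_trans ?_ (mul_le_mul_of_nonneg_left (eisensteinDensity_two_le p) (by positivity))
  have hp : (2 : ℝ) ≤ (p : ℕ) := by exact_mod_cast p.2.two_le
  have : eisensteinDensity (d + 2) p = (1 / ((p : ℕ) : ℝ)) ^ d * eisensteinDensity 2 p := by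
    unfold eisensteinDensity
    rw [show d + 2 + 2 = d + (2 + 2) by ring, pow_add _ d, one_div_pow]
    field_simp
  rw [this]
  have := eisensteinDensity_nonneg 2 p
  gcongr

lemma summable_densityMajorant_primeIndex (d : ℕ) :
    Summable fun p => (1 / 2 : ℝ) ^ d * densityMajorant (primeIndex p) :=
  (summable_densityMajorant.comp_injective primeIndex_injective).mul_left _

lemma summable_eisensteinDensity (d : ℕ) : Summable (eisensteinDensity (d + 2)) :=
  (summable_densityMajorant_primeIndex d).of_nonneg_of_le (eisensteinDensity_nonneg _)
    (eisensteinDensity_le d)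

lemma tsum_eisensteinDensity_lt (d : ℕ) :
    ∑' p, eisensteinDensity (d + 2) p < (1 / 2) ^ d * (1 / 4) := by
  calc ∑' p, eisensteinDensity (d + 2) p
      ≤ ∑' p, (1 / 2 : ℝ) ^ d * densityMajorant (primeIndex p) :=
        (summable_eisensteinDensity d).tsum_le_tsum (eisensteinDensity_le d)
          (summable_densityMajorant_primeIndex d)
    _ = (1 / 2) ^ d * ∑' p, densityMajorant (primeIndex p) := tsum_mul_left
    _ ≤ (1 / 2) ^ d * ∑' j, densityMajorant j := by
        gcongr
        exact (summable_densityMajorant.comp_injective primeIndex_injective).tsum_le_tsum_of_inj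
          primeIndex primeIndex_injective (fun j _ => densityMajorant_nonneg j) (fun _ => le_rfl)
          summable_densityMajorant
    _ ≤ (1 / 2) ^ d * (1 / 16 + 4 / 81 + 1 / 8) := by
        gcongr
        exact Real.tsum_le_of_sum_range_le densityMajorant_nonneg sum_range_densityMajorant_le
    _ < (1 / 2) ^ d * (1 / 4) := by gcongr; norm_num

lemma eisensteinDensity_le_one (n : ℕ) (p : Nat.Primes) : eisensteinDensity n p ≤ 1 := by
  have hp : (2 : ℝ) ≤ (p : ℕ) := by exact_mod_cast p.2.two_le
  unfold eisensteinDensity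
  rw [div_le_one (by positivity)]
  calc ((p : ℕ) - 1 : ℝ) ^ 2 ≤ ((p : ℕ) : ℝ) ^ 2 := by gcongr <;> linarith
    _ ≤ ((p : ℕ) : ℝ) ^ (n + 2) := pow_le_pow_right₀ (by linarith) (by omega)

lemma le_rho (d : ℕ) : (1 / 2 : ℝ) ^ d * (1 / 16) ≤ rho (d + 2) := by
  have hm : Multipliable fun p => 1 + -eisensteinDensity (d + 2) p :=
    Real.multipliable_one_add_of_summable (summable_eisensteinDensity d).neg
  have hprod : ∏' p, (1 + -eisensteinDensity (d + 2) p) ≤ 1 - (1 / 2 : ℝ) ^ d * (1 / 16) := by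
    have ht := hm.hasProd
    rw [HasProd, SummationFilter.unconditional_filter] at ht
    refine le_of_tendsto ht ?_
    filter_upwards [eventually_ge_atTop {(⟨2, Nat.prime_two⟩ : Nat.Primes)}] with s hs
    rw [← Finset.mul_prod_erase s _ (hs (Finset.mem_singleton_self _))]
    have hrest : ∏ p ∈ s.erase ⟨2, Nat.prime_two⟩, (1 + -eisensteinDensity (d + 2) p) ≤ 1 :=
      Finset.prod_le_one
        (fun p _ => by linarith [eisensteinDensity_le_one (d + 2) p])
        (fun p _ => by linarith [eisensteinDensity_nonneg (d + 2) p])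
    have htwo : eisensteinDensity (d + 2) ⟨2, Nat.prime_two⟩ = (1 / 2 : ℝ) ^ d * (1 / 16) := by
      simp only [eisensteinDensity]
      rw [one_div_pow, pow_add, pow_add]
      push_cast
      field_simp
      norm_num
    have h0 := eisensteinDensity_le_one (d + 2) ⟨2, Nat.prime_two⟩
    rw [htwo] at h0 ⊢
    exact (mul_le_of_le_one_right (by linarith) hrest).trans (by linarith)
  have : rho (d + 2) = 1 - ∏' p, (1 + -eisensteinDensity (d + 2) p) := by
    simp only [rho, eisensteinDensity, sub_eq_add_neg]
  linarith

lemma rho_pos (d : ℕ) : 0 < rho (d + 2) := lt_of_lt_of_le (by positivity) (le_rho d)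

lemma tau_eq (n : ℕ) :
    tau n = (∑' p, eisensteinDensity n p) ^ 2 - ∑' p, eisensteinDensity n p ^ 2 := by
  unfold tau eisensteinDensity
  congr 2
  ext p
  rw [div_pow, ← pow_mul, ← pow_mul]
  ring_nf

lemma tau_lt_rho (d : ℕ) : tau (d + 2) < rho (d + 2) := by
  have hS := tsum_eisensteinDensity_lt d
  have hS0 : 0 ≤ ∑' p, eisensteinDensity (d + 2) p := tsum_nonneg (eisensteinDensity_nonneg _)
  have hQ : 0 ≤ ∑' p, eisensteinDensity (d + 2) p ^ 2 := tsum_nonneg fun _ => sq_nonneg _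
  have ht : (0 : ℝ) < (1 / 2) ^ d := by positivity
  have ht1 : (1 / 2 : ℝ) ^ d ≤ 1 := pow_le_one₀ (by norm_num) (by norm_num)
  have := le_rho d
  rw [tau_eq]
  nlinarith [pow_lt_pow_left₀ hS hS0 two_ne_zero]

lemma tau_nonneg (d : ℕ) : 0 ≤ tau (d + 2) := by
  have hs := summable_eisensteinDensity d
  set S := ∑' p, eisensteinDensity (d + 2) p with hS
  have hle : ∀ p, eisensteinDensity (d + 2) p ^ 2 ≤ S * eisensteinDensity (d + 2) p := fun p => by
    rw [sq]
    exact mul_le_mul_of_nonneg_right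
      (hs.le_tsum p fun q _ => eisensteinDensity_nonneg _ q) (eisensteinDensity_nonneg _ p)
  have : ∑' p, eisensteinDensity (d + 2) p ^ 2 ≤ S * S := by
    rw [hS, ← tsum_mul_left]
    exact ((hs.mul_left S).of_nonneg_of_le (fun _ => sq_nonneg _) hle).tsum_le_tsum hle
      (hs.mul_left S)
  rw [tau_eq]
  nlinarith

lemma card_filter_dvd_linear_le (a u r q L : ℤ) (hq : 0 < q) (hL : 0 ≤ L) (hu : IsCoprime q u) :
    (((Finset.Ico a (a + L)).filter fun k => q ∣ u * k + r).card : ℝ) ≤ (L : ℝ) / q + 1 := by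
  have hq' : (0 : ℝ) < q := by exact_mod_cast hq
  have hL' : (0 : ℝ) ≤ L := by exact_mod_cast hL
  rcases Finset.eq_empty_or_nonempty ((Finset.Ico a (a + L)).filter fun k => q ∣ u * k + r)
    with h | ⟨v, hv⟩
  · rw [h]; simp; positivity
  · have hsub : ((Finset.Ico a (a + L)).filter fun k => q ∣ u * k + r) ⊆
        (Finset.Ico a (a + L)).filter fun k => k ≡ v [ZMOD q] := by
      intro k hk
      rw [Finset.mem_filter] at hk hv ⊢
      refine ⟨hk.1, Int.ModEq.symm (Int.modEq_iff_dvd.2 (hu.dvd_of_dvd_mul_left ?_))⟩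
      have := dvd_sub hk.2 hv.2
      rwa [show u * k + r - (u * v + r) = u * (k - v) by ring] at this
    refine (Nat.cast_le.2 (Finset.card_le_card hsub)).trans ?_
    have hc := Int.Ico_filter_modEq_card a (a + L) hq v
    have hbound : ((⌈((a + L : ℤ) - v : ℚ) / q⌉ - ⌈((a : ℚ) - v) / q⌉ : ℤ) : ℚ) ≤ L / q + 1 := by
      have h1 := Int.ceil_lt_add_one (((a + L : ℤ) - v : ℚ) / q)
      have h2 := Int.le_ceil (((a : ℚ) - v) / q)
      have h3 : ((a + L : ℤ) - v : ℚ) / q = ((a : ℚ) - v) / q + L / q := by push_cast; ring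
      rw [h3] at h1 ⊢
      push_cast
      linarith
    have hmax : ((max (⌈((a + L : ℤ) - v : ℚ) / q⌉ - ⌈((a : ℚ) - v) / q⌉) 0 : ℤ) : ℚ)
        ≤ L / q + 1 := by
      have hnn : (0 : ℚ) ≤ L / q + 1 := by
        have : (0 : ℚ) < q := by exact_mod_cast hq
        have : (0 : ℚ) ≤ L := by exact_mod_cast hL
        positivity
      rw [Int.cast_max]
      exact max_le hbound (by simpa using hnn)
    rw [← hc] at hmax
    exact_mod_cast hmax

lemma sum_inv_sq_odd_le (N : ℕ) :
    ∑ j ∈ Finset.Icc 1 N, 1 / (2 * (j : ℝ) + 1) ^ 2 ≤ 1 / 4 := by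
  have : ∑ j ∈ Finset.Icc 1 N, 1 / (2 * (j : ℝ) + 1) ^ 2 ≤ 1 / 4 - 1 / (4 * ((N : ℝ) + 1)) := by
    induction N with
    | zero => norm_num
    | succ N ih =>
      rw [Finset.sum_Icc_succ_top (by omega)]
      have : 1 / (2 * ((N + 1 : ℕ) : ℝ) + 1) ^ 2 ≤
          1 / (4 * ((N : ℝ) + 1)) - 1 / (4 * (((N + 1 : ℕ) : ℝ) + 1)) := by
        push_cast
        rw [div_sub_div _ _ (by positivity) (by positivity),
          div_le_div_iff₀ (by positivity) (by positivity)]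
        nlinarith [(Nat.cast_nonneg N : (0 : ℝ) ≤ N)]
      linarith
  have : 0 ≤ 1 / (4 * ((N : ℝ) + 1)) := by positivity
  linarith

/-- Parameters `(y, x, k)` for coefficient vectors: `k` for the constant term, `x` for the linear
one and `y` for the remaining ones. -/
abbrev CoeffParam (d : ℕ) : Type := (Fin (d + 1) → ℤ) × ℤ × ℤ

/-- The box of parameters of size `m`. -/
noncomputable def paramBox (d m : ℕ) : Finset (CoeffParam d) :=
  (Fintype.piFinset fun _ => Finset.Ico (-(2 * m : ℤ)) (-(2 * m : ℤ) + (4 * m : ℤ))) ×ˢ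
    Finset.Ico (-(2 * m : ℤ)) (-(2 * m : ℤ) + (4 * m : ℤ)) ×ˢ
      Finset.Ico (-(m : ℤ)) (-(m : ℤ) + (2 * m : ℤ))

lemma card_paramBox (d m : ℕ) : (paramBox d m).card = (4 * m) ^ (d + 1) * (4 * m * (2 * m)) := by
  have h4 : (4 * m : ℤ).toNat = 4 * m := by omega
  have h2 : (2 * m : ℤ).toNat = 2 * m := by omega
  simp [paramBox, Finset.card_product, h4, h2]

/-- The parameters for which `q` divides both the constant and the linear coefficient. -/
noncomputable def badParams (d m : ℕ) (c : ℤ) (r : (Fin (d + 1) → ℤ) → ℤ → ℤ) (q : ℤ) :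
    Finset (CoeffParam d) :=
  (paramBox d m).filter fun t => q ∣ 2 * t.2.1 + c ∧ q ∣ 4 * t.2.2 + r t.1 t.2.1

lemma card_badParams_le (d m : ℕ) (c : ℤ) (r : (Fin (d + 1) → ℤ) → ℤ → ℤ) (q : ℤ) (hq : 0 < q)
    (hodd : IsCoprime q 2) :
    ((badParams d m c r q).card : ℝ) ≤
      (4 * m : ℝ) ^ (d + 1) * ((4 * m / q + 1) * (2 * m / q + 1)) := by
  have hq' : (0 : ℝ) < q := by exact_mod_cast hq
  have hfour : IsCoprime q 4 := by
    have := hodd.pow_right (n := 2)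
    norm_num at this
    exact this
  have hk : ∀ y x, (((Finset.Ico (-(m : ℤ)) (-(m : ℤ) + (2 * m : ℤ))).filter
      fun k => q ∣ 4 * k + r y x).card : ℝ) ≤ 2 * m / q + 1 := fun y x => by
    have := card_filter_dvd_linear_le (-(m : ℤ)) 4 (r y x) q (2 * m) hq (by positivity) hfour
    simpa using this
  have hx : (((Finset.Ico (-(2 * m : ℤ)) (-(2 * m : ℤ) + (4 * m : ℤ))).filter
      fun x => q ∣ 2 * x + c).card : ℝ) ≤ 4 * m / q + 1 := by
    have := card_filter_dvd_linear_le (-(2 * m : ℤ)) 2 c q (4 * m) hq (by positivity) hodd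
    simpa using this
  have hy : ((Fintype.piFinset fun _ : Fin (d + 1) =>
      Finset.Ico (-(2 * m : ℤ)) (-(2 * m : ℤ) + (4 * m : ℤ))).card : ℝ) =
      (4 * m : ℝ) ^ (d + 1) := by
    have h4 : (4 * m : ℤ).toNat = 4 * m := by omega
    simp [h4]
  rw [badParams, paramBox, Finset.card_filter, Finset.sum_product, ← hy, ← nsmul_eq_mul]
  push_cast
  refine Finset.sum_le_card_nsmul _ _ _ fun y _ => ?_
  rw [Finset.sum_product]
  calc _ ≤ ∑ x ∈ Finset.Ico (-(2 * m : ℤ)) (-(2 * m : ℤ) + (4 * m : ℤ)),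
        if q ∣ 2 * x + c then (2 * m / q + 1 : ℝ) else 0 := by
        refine Finset.sum_le_sum fun x _ => ?_
        by_cases h : q ∣ 2 * x + c
        · have := hk y x
          rw [Finset.card_filter] at this
          push_cast at this
          simpa [h] using this
        · simp [h]
    _ ≤ _ := by
        rw [← Finset.sum_filter, Finset.sum_const, nsmul_eq_mul]
        exact mul_le_mul_of_nonneg_right hx (by positivity)

/-- The parameters for which no odd number `q` with `3 ≤ q ≤ 4m + 3` divides both the constant and
the linear coefficient. -/
noncomputable def goodParams (d m : ℕ) (c : ℤ) (r : (Fin (d + 1) → ℤ) → ℤ → ℤ) : Finset (CoeffParam d) :=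
  paramBox d m \ (Finset.Icc 1 (2 * m + 1)).biUnion fun j => badParams d m c r (2 * j + 1)

lemma le_card_goodParams (d m : ℕ) (hm : 8 ≤ m) (c : ℤ) (r : (Fin (d + 1) → ℤ) → ℤ → ℤ) :
    (4 * m : ℝ) ^ (d + 1) * (3 * m ^ 2) ≤ (goodParams d m c r).card := by
  set T := (Finset.Icc 1 (2 * m + 1)).biUnion fun j => badParams d m c r (2 * j + 1)
    with hT
  have hbad : (T.card : ℝ) ≤
      (4 * m : ℝ) ^ (d + 1) * (4 * m ^ 2 + 17 / 8 * (2 * m + 1)) := by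
    calc (T.card : ℝ) ≤ ∑ j ∈ Finset.Icc 1 (2 * m + 1),
          ((badParams d m c r (2 * j + 1)).card : ℝ) := by
          exact_mod_cast Finset.card_biUnion_le
      _ ≤ ∑ j ∈ Finset.Icc 1 (2 * m + 1), (4 * m : ℝ) ^ (d + 1) *
          (16 * m ^ 2 * (1 / (2 * (j : ℝ) + 1) ^ 2) + 17 / 8) := by
          refine Finset.sum_le_sum fun j _ => ?_
          refine (card_badParams_le d m c r (2 * j + 1) (by positivity)
            ⟨1, -j, by ring⟩).trans ?_
          push_cast
          gcongr
          have e1 : (4 * m / (2 * (j : ℝ) + 1) + 1) * (2 * m / (2 * (j : ℝ) + 1) + 1) =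
            8 * (m / (2 * (j : ℝ) + 1)) ^ 2 + 6 * (m / (2 * (j : ℝ) + 1)) + 1 := by ring
          have e2 : 16 * (m : ℝ) ^ 2 * (1 / (2 * (j : ℝ) + 1) ^ 2) =
            16 * (m / (2 * (j : ℝ) + 1)) ^ 2 := by rw [div_pow]; ring
          rw [e1, e2]
          nlinarith [sq_nonneg (8 * ((m : ℝ) / (2 * (j : ℝ) + 1)) - 3)]
      _ = (4 * m : ℝ) ^ (d + 1) * (16 * m ^ 2 * (∑ j ∈ Finset.Icc 1 (2 * m + 1),
          1 / (2 * (j : ℝ) + 1) ^ 2) + 17 / 8 * (2 * m + 1)) := by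
          rw [← Finset.mul_sum, Finset.sum_add_distrib, ← Finset.mul_sum, Finset.sum_const,
            Nat.card_Icc, nsmul_eq_mul, Nat.add_sub_cancel]
          push_cast
          ring
      _ ≤ _ := by
          have := sum_inv_sq_odd_le (2 * m + 1)
          have := mul_le_mul_of_nonneg_left this (by positivity : (0 : ℝ) ≤ 16 * m ^ 2)
          refine mul_le_mul_of_nonneg_left ?_ (by positivity)
          linarith
  have hsplit : (paramBox d m).card ≤ (goodParams d m c r).card + T.card := by
    have := Finset.le_card_sdiff T (paramBox d m)
    rw [goodParams, ← hT]
    omega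
  have hsplit' : ((paramBox d m).card : ℝ) ≤ (goodParams d m c r).card + T.card := by
    exact_mod_cast hsplit
  rw [card_paramBox] at hsplit'
  push_cast at hsplit'
  have hm' : (8 : ℝ) ≤ m := by exact_mod_cast hm
  have hp : (0 : ℝ) ≤ (4 * m : ℝ) ^ (d + 1) := by positivity
  have : (4 * m : ℝ) ^ (d + 1) * (3 * m ^ 2 + (4 * m ^ 2 + 17 / 8 * (2 * m + 1))) ≤
      (4 * m : ℝ) ^ (d + 1) * (4 * m * (2 * m)) := by
    gcongr
    nlinarith
  linarith

/-- The polynomial of degree at most `d + 2` with coefficients `4k + r y x`, `2x + c 1` and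
`2 yᵢ + c (i + 2)`. -/
noncomputable def paramPoly {d : ℕ} (c : ℕ → ℤ) (r : (Fin (d + 1) → ℤ) → ℤ → ℤ)
    (t : CoeffParam d) : ℤ[X] :=
  ofFn (d + 3) (Fin.cons (4 * t.2.2 + r t.1 t.2.1)
    (Fin.cons (2 * t.2.1 + c 1) fun i : Fin (d + 1) => 2 * t.1 i + c (i + 2)))

section paramPoly

variable {d : ℕ} (c : ℕ → ℤ) (r : (Fin (d + 1) → ℤ) → ℤ → ℤ) (t : CoeffParam d)

lemma paramPoly_coeff_zero : (paramPoly c r t).coeff 0 = 4 * t.2.2 + r t.1 t.2.1 := by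
  rw [paramPoly, ofFn_coeff_eq_val_of_lt _ (by omega : 0 < d + 3)]
  rfl

lemma paramPoly_coeff_one : (paramPoly c r t).coeff 1 = 2 * t.2.1 + c 1 := by
  rw [paramPoly, ofFn_coeff_eq_val_of_lt _ (by omega : 1 < d + 3)]
  rfl

lemma paramPoly_coeff_add_two (i : Fin (d + 1)) :
    (paramPoly c r t).coeff (i + 2) = 2 * t.1 i + c (i + 2) := by
  rw [paramPoly, ofFn_coeff_eq_val_of_lt _ (by omega : (i : ℕ) + 2 < d + 3)]
  rfl

lemma paramPoly_coeff_eq_zero {i : ℕ} (hi : d + 3 ≤ i) : (paramPoly c r t).coeff i = 0 :=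
  ofFn_coeff_eq_zero_of_ge _ hi

lemma paramPoly_injective : Function.Injective (paramPoly c r) := by
  intro t t' h
  have hy : t.1 = t'.1 := by
    ext i
    have := congrArg (fun f => f.coeff (i + 2)) h
    simp only [paramPoly_coeff_add_two] at this
    linarith
  have hx : t.2.1 = t'.2.1 := by
    have := congrArg (fun f => f.coeff 1) h
    simp only [paramPoly_coeff_one] at this
    linarith
  have hk : t.2.2 = t'.2.2 := by
    have := congrArg (fun f => f.coeff 0) h
    simp only [paramPoly_coeff_zero, hy, hx] at this
    linarith
  exact Prod.ext hy (Prod.ext hx hk)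

/-- Above the constant term, the parity of the coefficients is prescribed by `c`. -/
lemma two_dvd_paramPoly_coeff_sub {i : ℕ} (h0 : i ≠ 0) (hi : i < d + 3) :
    (2 : ℤ) ∣ (paramPoly c r t).coeff i - c i := by
  obtain rfl | ⟨j, rfl⟩ : i = 1 ∨ ∃ j, i = j + 2 := by
    rcases i with _ | _ | j
    · exact absurd rfl h0
    · exact Or.inl rfl
    · exact Or.inr ⟨j, rfl⟩
  · rw [paramPoly_coeff_one]
    exact ⟨t.2.1, by ring⟩
  · have := paramPoly_coeff_add_two c r t ⟨j, by omega⟩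
    simp only at this
    rw [this]
    exact ⟨_, by ring⟩

lemma paramPoly_natDegree (hc : c (d + 2) = 1) : (paramPoly c r t).natDegree = d + 2 := by
  refine natDegree_eq_of_le_of_coeff_ne_zero
    (Nat.lt_succ_iff.1 (ofFn_natDegree_lt (by omega) _)) fun h => ?_
  have := two_dvd_paramPoly_coeff_sub c r t (by omega : d + 2 ≠ 0) (by omega)
  rw [h, hc] at this
  omega

lemma paramPoly_leadingCoeff_odd (hc : c (d + 2) = 1) :
    ¬ (2 : ℤ) ∣ (paramPoly c r t).leadingCoeff := by
  have := two_dvd_paramPoly_coeff_sub c r t (by omega : d + 2 ≠ 0) (by omega)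
  rw [leadingCoeff, paramPoly_natDegree c r t hc]
  rw [hc] at this
  omega

lemma paramPoly_coeff_zero_natAbs_le {m : ℕ} (hr : ∀ y x, 0 ≤ r y x ∧ r y x ≤ 3)
    (ht : t ∈ paramBox d m) : ((paramPoly c r t).coeff 0).natAbs ≤ 4 * m + 3 := by
  simp only [paramBox, Finset.mem_product, Finset.mem_Ico] at ht
  rw [paramPoly_coeff_zero]
  have := hr t.1 t.2.1
  omega

lemma polyHeight_paramPoly_le {m H : ℕ} (hH : 4 * m + 3 ≤ H) (hc : ∀ i, 0 ≤ c i ∧ c i ≤ 1)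
    (hr : ∀ y x, 0 ≤ r y x ∧ r y x ≤ 3) (ht : t ∈ paramBox d m) :
    polyHeight (paramPoly c r t) ≤ H := by
  refine Finset.sup_le fun i _ => ?_
  rcases i with _ | _ | j
  · exact (paramPoly_coeff_zero_natAbs_le c r t hr ht).trans hH
  · simp only [paramBox, Finset.mem_product, Finset.mem_Ico] at ht
    rw [zero_add, paramPoly_coeff_one]
    have := hc 1
    omega
  · by_cases hj : j < d + 1
    · simp only [paramBox, Finset.mem_product, Fintype.mem_piFinset, Finset.mem_Ico] at ht
      have h1 := paramPoly_coeff_add_two c r t ⟨j, hj⟩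
      have h2 := ht.1 ⟨j, hj⟩
      have h3 := hc (j + 2)
      simp only at h1
      rw [h1]
      omega
    · rw [paramPoly_coeff_eq_zero c r t (by omega)]
      simp

end paramPoly

lemma natAbs_coeff_le_polyHeight (f : ℤ[X]) {i : ℕ} (hi : i ≤ f.natDegree) :
    (f.coeff i).natAbs ≤ polyHeight f :=
  Finset.le_sup (f := fun i => (f.coeff i).natAbs) (Finset.mem_range.2 (by omega))

/-- The polynomials of degree exactly `n` and height at most `H`. -/
def heightBox (n H : ℕ) : Set ℤ[X] := {f | f.natDegree = n ∧ polyHeight f ≤ H}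

lemma heightBox_subset_image (n H : ℕ) :
    heightBox n H ⊆ ((Fintype.piFinset fun _ : Fin (n + 1) =>
      Finset.Icc (-(H : ℤ)) H).image (ofFn (n + 1)) : Finset ℤ[X]) := by
  rintro f ⟨hn, hH⟩
  rw [Finset.mem_coe, Finset.mem_image]
  refine ⟨toFn (n + 1) f, ?_, ofFn_comp_toFn_eq_id_of_natDegree_lt (by omega)⟩
  rw [Fintype.mem_piFinset]
  intro i
  have h1 := natAbs_coeff_le_polyHeight f (i := i) (by omega)
  have h2 : toFn (n + 1) f i = f.coeff i := rfl
  rw [Finset.mem_Icc, h2]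
  omega

lemma heightBox_finite (n H : ℕ) : (heightBox n H).Finite :=
  (Finset.finite_toSet _).subset (heightBox_subset_image n H)

lemma ncard_heightBox_le (n H : ℕ) : (heightBox n H).ncard ≤ (2 * H + 1) ^ (n + 1) := by
  refine (Set.ncard_le_ncard (heightBox_subset_image n H) (Finset.finite_toSet _)).trans ?_
  rw [Set.ncard_coe_finset]
  refine Finset.card_image_le.trans ?_
  have : ((H : ℤ) + 1 + H).toNat = 2 * H + 1 := by omega
  simp [this]

lemma eisensteinSet_subset_heightBox (n H : ℕ) : EisensteinSet n H ⊆ heightBox n H :=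
  fun _ hf => ⟨hf.1, hf.2.1⟩

lemma shiftedEisensteinSet_subset_heightBox (n H : ℕ) :
    shiftedEisensteinSet n H ⊆ heightBox n H :=
  fun _ hf => ⟨hf.1, hf.2.1⟩

lemma eisensteinSet_subset_shifted (n H : ℕ) : EisensteinSet n H ⊆ shiftedEisensteinSet n H :=
  fun f hf => ⟨hf.1, hf.2.1, 0, by simpa using hf.2.2⟩

lemma card_le_ncard_of_paramPoly {d : ℕ} (c : ℕ → ℤ) (r : (Fin (d + 1) → ℤ) → ℤ → ℤ)
    (S : Finset (CoeffParam d)) {T : Set ℤ[X]} (hT : T.Finite)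
    (h : ∀ t ∈ S, paramPoly c r t ∈ T) : S.card ≤ T.ncard := by
  rw [← Set.ncard_coe_finset, ← Set.ncard_image_of_injective _ (paramPoly_injective c r)]
  refine Set.ncard_le_ncard ?_ hT
  rintro _ ⟨t, ht, rfl⟩
  exact h t ht

lemma le_ncard_eisensteinSet (d m H : ℕ) (hH : 4 * m + 3 ≤ H) :
    (4 * m) ^ (d + 1) * (4 * m * (2 * m)) ≤ (EisensteinSet (d + 2) H).ncard := by
  set c : ℕ → ℤ := fun i => if i = d + 2 then 1 else 0 with hcdef
  set r : (Fin (d + 1) → ℤ) → ℤ → ℤ := fun _ _ => 2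
  have hc : c (d + 2) = 1 := by simp [hcdef]
  rw [← card_paramBox]
  refine card_le_ncard_of_paramPoly c r _
    ((heightBox_finite _ H).subset (eisensteinSet_subset_heightBox _ H)) fun t ht => ?_
  have hdeg := paramPoly_natDegree c r t hc
  refine ⟨hdeg, polyHeight_paramPoly_le c r t hH (fun i => ?_) (fun _ _ => ?_) ht, 2,
    Nat.prime_two, ?_, ?_, paramPoly_leadingCoeff_odd c r t hc⟩
  · simp only [hcdef]; split_ifs <;> simp
  · simp [r]
  · intro i hi
    rw [hdeg] at hi
    by_cases h0 : i = 0
    · subst h0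
      rw [paramPoly_coeff_zero]
      simp only [r, Nat.cast_ofNat]
      omega
    · have := two_dvd_paramPoly_coeff_sub c r t h0 (by omega)
      have hci : c i = 0 := by simp [hcdef, hi.ne]
      rw [hci, sub_zero] at this
      exact_mod_cast this
  · rw [paramPoly_coeff_zero]
    simp only [r, Nat.cast_ofNat]
    omega

/-- The parities of the coefficients of `(X + 1) ^ n`. -/
def chooseParity (n i : ℕ) : ℤ := (n.choose i % 2 : ℕ)

/-- The residue mod `4` of the constant term for which the value at `1` is `2` mod `4`. -/
def constResidue (d : ℕ) (y : Fin (d + 1) → ℤ) (x : ℤ) : ℤ :=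
  (2 - (2 * x + chooseParity (d + 2) 1) -
    ∑ i : Fin (d + 1), (2 * y i + chooseParity (d + 2) (i + 2))) % 4

/-- The polynomials with the parities of `(X + 1) ^ (d + 2)` and value `2` mod `4` at `1`. -/
noncomputable def shiftPoly {d : ℕ} (t : CoeffParam d) : ℤ[X] :=
  paramPoly (chooseParity (d + 2)) (constResidue d) t

section shiftPoly

variable {d : ℕ} (t : CoeffParam d)

lemma chooseParity_mem (n i : ℕ) : 0 ≤ chooseParity n i ∧ chooseParity n i ≤ 1 := by
  unfold chooseParity; omega

lemma chooseParity_self (n : ℕ) : chooseParity n n = 1 := by simp [chooseParity]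

lemma intCast_chooseParity (n i : ℕ) : ((chooseParity n i : ℤ) : ZMod 2) = n.choose i := by
  rw [chooseParity, Int.cast_natCast, ZMod.natCast_mod]

lemma constResidue_mem (y : Fin (d + 1) → ℤ) (x : ℤ) :
    0 ≤ constResidue d y x ∧ constResidue d y x ≤ 3 := by
  unfold constResidue; omega

lemma shiftPoly_natDegree : (shiftPoly t).natDegree = d + 2 :=
  paramPoly_natDegree _ _ t (chooseParity_self _)

lemma shiftPoly_eval_one : (shiftPoly t).eval 1 % 4 = 2 := by
  have h : (shiftPoly t).eval 1 = 4 * t.2.2 + constResidue d t.1 t.2.1 +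
      (2 * t.2.1 + chooseParity (d + 2) 1) +
      ∑ i : Fin (d + 1), (2 * t.1 i + chooseParity (d + 2) (i + 2)) := by
    rw [eval_eq_sum_range, shiftPoly_natDegree, Finset.sum_range, Fin.sum_univ_succ,
      Fin.sum_univ_succ, ← add_assoc]
    simp only [one_pow, mul_one]
    refine congrArg₂ _ (congrArg₂ _ (paramPoly_coeff_zero _ _ t) (paramPoly_coeff_one _ _ t))
      (Finset.sum_congr rfl fun i _ => ?_)
    exact paramPoly_coeff_add_two _ _ t i
  rw [h, constResidue]
  omega

lemma shiftPoly_coeff_cast {i : ℕ} (h0 : i ≠ 0) :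
    (((shiftPoly t).coeff i : ℤ) : ZMod 2) = (d + 2).choose i := by
  by_cases hi : i < d + 3
  · rw [← intCast_chooseParity, ← sub_eq_zero, ← Int.cast_sub, ZMod.intCast_zmod_eq_zero_iff_dvd]
    exact_mod_cast two_dvd_paramPoly_coeff_sub _ _ t h0 hi
  · rw [shiftPoly, paramPoly_coeff_eq_zero _ _ t (by omega), Nat.choose_eq_zero_of_lt (by omega)]
    simp

lemma shiftPoly_map : (shiftPoly t).map (Int.castRingHom (ZMod 2)) = (X + 1) ^ (d + 2) := by
  have hne : ∀ i, i ≠ 0 → ((shiftPoly t).map (Int.castRingHom (ZMod 2))).coeff i =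
      ((X + 1 : (ZMod 2)[X]) ^ (d + 2)).coeff i := fun i hi => by
    rw [coeff_map, coeff_X_add_one_pow]
    exact shiftPoly_coeff_cast t hi
  have hconst : (shiftPoly t).map (Int.castRingHom (ZMod 2)) - (X + 1) ^ (d + 2) =
      C (((shiftPoly t).map (Int.castRingHom (ZMod 2)) - (X + 1) ^ (d + 2)).coeff 0) := by
    ext i
    by_cases hi : i = 0
    · simp [hi]
    · rw [coeff_sub, hne i hi, sub_self, coeff_C, if_neg hi]
  have heval : ((shiftPoly t).map (Int.castRingHom (ZMod 2)) - (X + 1) ^ (d + 2)).eval 1 = 0 := by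
    have h1 : (((shiftPoly t).eval 1 : ℤ) : ZMod 2) = 0 := by
      rw [ZMod.intCast_zmod_eq_zero_iff_dvd]
      have := shiftPoly_eval_one t
      push_cast
      omega
    have h2 : (1 + 1 : ZMod 2) = 0 := by decide
    rw [eval_sub, eval_pow, eval_add, eval_X, eval_one, h2, zero_pow (by omega), sub_zero,
      eval_one_map]
    exact h1
  rw [hconst, eval_C] at heval
  rw [heval, C_0] at hconst
  exact sub_eq_zero.1 hconst

lemma shiftPoly_coeff_zero_odd : ¬ (2 : ℤ) ∣ (shiftPoly t).coeff 0 := by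
  have h := congrArg (fun f => f.coeff 0) (shiftPoly_map t)
  simp only [coeff_map, coeff_X_add_one_pow, Nat.choose_zero_right, Nat.cast_one] at h
  intro hd
  have : (((shiftPoly t).coeff 0 : ℤ) : ZMod 2) = 0 := by
    rw [ZMod.intCast_zmod_eq_zero_iff_dvd]
    exact_mod_cast hd
  rw [eq_intCast, this] at h
  exact zero_ne_one h

lemma shiftPoly_comp_isEisenstein : IsEisenstein ((shiftPoly t).comp (X + C 1)) := by
  have hdeg : ((shiftPoly t).comp (X + C 1)).natDegree = d + 2 := by
    rw [natDegree_comp, natDegree_X_add_C, mul_one, shiftPoly_natDegree]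
  refine ⟨2, Nat.prime_two, fun i hi => ?_, ?_, ?_⟩
  · rw [hdeg] at hi
    have hmap : ((shiftPoly t).comp (X + C 1)).map (Int.castRingHom (ZMod 2)) = X ^ (d + 2) := by
      have h2 : (1 + 1 : (ZMod 2)[X]) = 0 := by
        rw [one_add_one_eq_two]; exact CharTwo.two_eq_zero
      rw [Polynomial.map_comp, shiftPoly_map]
      simp [add_assoc, h2]
    have := congrArg (fun f => f.coeff i) hmap
    simp only [coeff_map, coeff_X_pow, if_neg hi.ne] at this
    rw [← ZMod.intCast_zmod_eq_zero_iff_dvd]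
    exact this
  · rw [coeff_zero_eq_eval_zero, eval_comp]
    have := shiftPoly_eval_one t
    simp only [eval_add, eval_X, eval_C, zero_add, Nat.cast_ofNat]
    omega
  · rw [leadingCoeff_comp (by rw [natDegree_X_add_C]; exact one_ne_zero),
      leadingCoeff_X_add_C, one_pow, mul_one]
    exact_mod_cast paramPoly_leadingCoeff_odd _ _ t (chooseParity_self _)

lemma shiftPoly_not_isEisenstein {m : ℕ}
    (ht : t ∈ goodParams d m (chooseParity (d + 2) 1) (constResidue d)) :
    ¬ IsEisenstein (shiftPoly t) := by
  rintro ⟨p, hp, hdvd, -, -⟩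
  rw [shiftPoly_natDegree] at hdvd
  obtain ⟨hbox, hbad⟩ := Finset.mem_sdiff.1 ht
  have h0 := hdvd 0 (by omega)
  have h1 := hdvd 1 (by omega)
  have hodd := shiftPoly_coeff_zero_odd t
  have hne : (shiftPoly t).coeff 0 ≠ 0 := fun h => hodd (h ▸ dvd_zero _)
  have hp2 : p ≠ 2 := fun h => hodd (by subst h; exact_mod_cast h0)
  have hle : p ≤ 4 * m + 3 :=
    (Nat.le_of_dvd (Int.natAbs_pos.2 hne) (Int.natCast_dvd.1 h0)).trans
      (paramPoly_coeff_zero_natAbs_le _ _ t constResidue_mem hbox)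
  have hge := hp.two_le
  have hmod := hp.eq_two_or_odd
  have hpj : (p : ℤ) = 2 * (p / 2 : ℕ) + 1 := by omega
  refine hbad (Finset.mem_biUnion.2 ⟨p / 2, Finset.mem_Icc.2 ⟨by omega, by omega⟩,
    Finset.mem_filter.2 ⟨hbox, ?_, ?_⟩⟩)
  · rwa [← hpj, ← paramPoly_coeff_one]
  · rwa [← hpj, ← paramPoly_coeff_zero]

end shiftPoly

lemma card_goodParams_le (d m H : ℕ) (hH : 4 * m + 3 ≤ H) :
    (goodParams d m (chooseParity (d + 2) 1) (constResidue d)).card ≤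
      (shiftedEisensteinSet (d + 2) H \ EisensteinSet (d + 2) H).ncard := by
  refine card_le_ncard_of_paramPoly (chooseParity (d + 2)) (constResidue d) _
    (((heightBox_finite _ H).subset (shiftedEisensteinSet_subset_heightBox _ H)).subset
      Set.sdiff_subset) fun t ht => ?_
  refine ⟨⟨shiftPoly_natDegree t, polyHeight_paramPoly_le _ _ t hH (chooseParity_mem _)
    constResidue_mem (Finset.mem_sdiff.1 ht).1, 1, shiftPoly_comp_isEisenstein t⟩, fun h => ?_⟩
  exact shiftPoly_not_isEisenstein t ht h.2.2

/-- The two bounds on the sizes of the sets, at a height `H` between `4m + 3` and `4m + 6`. -/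
lemma card_bounds (d m H : ℕ) (hm : 13 ≤ m) (hH : 4 * m + 3 ≤ H) (hH' : H ≤ 4 * m + 6) :
    0 < (Nat.card (EisensteinSet (d + 2) H) : ℝ) ∧
    (Nat.card (EisensteinSet (d + 2) H) : ℝ) * (1 + 1 / 2 ^ ((d + 2) ^ 2 + (d + 2))) ≤
      Nat.card (shiftedEisensteinSet (d + 2) H) ∧
    (Nat.card (shiftedEisensteinSet (d + 2) H) : ℝ) ≤
      (9 / 4) ^ (d + 3) * 2 * Nat.card (EisensteinSet (d + 2) H) := by
  have hm' : (13 : ℝ) ≤ m := by exact_mod_cast hm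
  have hSfin := (heightBox_finite _ H).subset (shiftedEisensteinSet_subset_heightBox (d + 2) H)
  rw [Nat.card_coe_set_eq, Nat.card_coe_set_eq]
  have hbox : ((heightBox (d + 2) H).ncard : ℝ) ≤ (9 / 4) ^ (d + 3) * (4 * m) ^ (d + 3) := by
    have h1 : ((heightBox (d + 2) H).ncard : ℝ) ≤ (2 * H + 1) ^ (d + 3) := by
      exact_mod_cast ncard_heightBox_le (d + 2) H
    have h2 : (H : ℝ) ≤ 4 * m + 6 := by exact_mod_cast hH'
    refine h1.trans ?_
    rw [← mul_pow]
    gcongr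
    linarith
  have hElow : (4 * m : ℝ) ^ (d + 3) / 2 ≤ (EisensteinSet (d + 2) H).ncard := by
    have h := le_ncard_eisensteinSet d m H hH
    have h' : (4 * m : ℝ) ^ (d + 1) * (4 * m * (2 * m)) ≤ (EisensteinSet (d + 2) H).ncard := by
      exact_mod_cast h
    refine le_trans (le_of_eq ?_) h'
    ring
  have hEup : ((EisensteinSet (d + 2) H).ncard : ℝ) ≤ (heightBox (d + 2) H).ncard := by
    exact_mod_cast Set.ncard_le_ncard (eisensteinSet_subset_heightBox _ H) (heightBox_finite _ H)
  have hSup : ((shiftedEisensteinSet (d + 2) H).ncard : ℝ) ≤ (heightBox (d + 2) H).ncard := by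
    exact_mod_cast Set.ncard_le_ncard (shiftedEisensteinSet_subset_heightBox _ H)
      (heightBox_finite _ H)
  have hdiff : (4 * m : ℝ) ^ (d + 3) * (3 / 16) ≤
      (shiftedEisensteinSet (d + 2) H \ EisensteinSet (d + 2) H).ncard := by
    have h1 := le_card_goodParams d m (by omega) (chooseParity (d + 2) 1) (constResidue d)
    have h2 : ((goodParams d m (chooseParity (d + 2) 1) (constResidue d)).card : ℝ) ≤
        (shiftedEisensteinSet (d + 2) H \ EisensteinSet (d + 2) H).ncard := by
      exact_mod_cast card_goodParams_le d m H hH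
    refine le_trans (le_of_eq ?_) (h1.trans h2)
    ring
  have hsum : ((shiftedEisensteinSet (d + 2) H).ncard : ℝ) =
      (shiftedEisensteinSet (d + 2) H \ EisensteinSet (d + 2) H).ncard +
        (EisensteinSet (d + 2) H).ncard := by
    exact_mod_cast (Set.ncard_sdiff_add_ncard_of_subset (eisensteinSet_subset_shifted _ H)
      hSfin).symm
  have hP : (0 : ℝ) < (4 * m) ^ (d + 3) := by positivity
  have hconst : (9 / 4 : ℝ) ^ (d + 3) * (1 / 2 ^ ((d + 2) ^ 2 + (d + 2))) ≤ 3 / 16 := by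
    have hexp : (2 : ℝ) ^ ((d + 2) ^ 2 + (d + 2)) = (2 ^ (d + 2)) ^ (d + 3) := by
      rw [← pow_mul]; ring_nf
    have hfour : (4 : ℝ) ≤ 2 ^ (d + 2) := by
      have : (1 : ℝ) ≤ 2 ^ d := one_le_pow₀ (by norm_num)
      rw [pow_add]; linarith
    calc (9 / 4 : ℝ) ^ (d + 3) * (1 / 2 ^ ((d + 2) ^ 2 + (d + 2)))
        ≤ (9 / 4 : ℝ) ^ (d + 3) * (1 / 4 ^ (d + 3)) := by
          rw [hexp]; gcongr
      _ = (9 / 16 : ℝ) ^ (d + 3) := by rw [mul_one_div, ← div_pow]; norm_num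
      _ ≤ (9 / 16 : ℝ) ^ 3 := pow_le_pow_of_le_one (by norm_num) (by norm_num) (by omega)
      _ ≤ 3 / 16 := by norm_num
  refine ⟨by linarith, ?_, ?_⟩
  · rw [hsum, mul_add, mul_one, add_comm]
    refine add_le_add ?_ le_rfl
    calc ((EisensteinSet (d + 2) H).ncard : ℝ) * (1 / (2 : ℝ) ^ ((d + 2) ^ 2 + (d + 2)))
        ≤ (9 / 4) ^ (d + 3) * (4 * m) ^ (d + 3) * (1 / (2 : ℝ) ^ ((d + 2) ^ 2 + (d + 2))) := by
          gcongr; exact hEup.trans hbox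
      _ = (4 * m) ^ (d + 3) * ((9 / 4) ^ (d + 3) * (1 / (2 : ℝ) ^ ((d + 2) ^ 2 + (d + 2)))) := by ring
      _ ≤ (4 * m) ^ (d + 3) * (3 / 16) := mul_le_mul_of_nonneg_left hconst hP.le
      _ ≤ _ := hdiff
  · calc ((shiftedEisensteinSet (d + 2) H).ncard : ℝ)
        ≤ (9 / 4) ^ (d + 3) * (4 * m) ^ (d + 3) := hSup.trans hbox
      _ = (9 / 4) ^ (d + 3) * 2 * ((4 * m) ^ (d + 3) / 2) := by ring
      _ ≤ _ := by gcongr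

/-- For `n ≥ 2`: `liminf_{H→∞} #Ē_n(H)/#E_n(H) ≥ 1 + γₙ` where
`γₙ = 2^{-(n²+n)}(1 - τₙ/ρₙ)`; moreover `γₙ > 0`. -/
theorem liminf_shifted_ratio (n : ℕ) (hn : 2 ≤ n) :
    (0 : ℝ) < 1 / 2^(n^2 + n) * (1 - tau n / rho n) ∧
    1 + 1 / 2^(n^2 + n) * (1 - tau n / rho n) ≤
      liminf (fun H : ℕ =>
        (Nat.card (shiftedEisensteinSet n H) : ℝ) / (Nat.card (EisensteinSet n H) : ℝ))
        atTop := by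
  obtain ⟨d, rfl⟩ : ∃ d, n = d + 2 := ⟨n - 2, by omega⟩
  have hρ := rho_pos d
  have hγ : 1 - tau (d + 2) / rho (d + 2) ≤ 1 := by
    linarith [div_nonneg (tau_nonneg d) hρ.le]
  have hpos : 0 < 1 - tau (d + 2) / rho (d + 2) := by
    rw [sub_pos, div_lt_one hρ]
    exact tau_lt_rho d
  have hbounds := fun (H : ℕ) (hH : 55 ≤ H) =>
    card_bounds d ((H - 3) / 4) H (by omega) (by omega) (by omega)
  refine ⟨by positivity, le_liminf_of_le ?_ ?_⟩
  · refine IsBoundedUnder.isCoboundedUnder_ge ⟨(9 / 4) ^ (d + 3) * 2, ?_⟩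
    rw [eventually_map]
    filter_upwards [eventually_ge_atTop 55] with H hH
    obtain ⟨hE, -, hup⟩ := hbounds H hH
    rwa [div_le_iff₀ hE]
  · filter_upwards [eventually_ge_atTop 55] with H hH
    obtain ⟨hE, hlow, -⟩ := hbounds H hH
    rw [le_div_iff₀ hE, mul_comm]
    refine le_trans ?_ hlow
    gcongr
    exact mul_le_of_le_one_right (by positivity) hγ
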